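/- Let μ > 10. Then for every y ∈ ℓ¹ there exists a unique a ∈ ℓ¹ such that L_μ a = y, and this solution satisfies ‖a‖_{ℓ¹} ≤ C(μ)·‖y‖_{ℓ¹}, where C(μ) = 1.612 + 0.1 if 10 < μ ≤ 100, C(μ) = 1.472 + 0.01 if 100 < μ ≤ 1000, and C(μ) = 1.454 + 0.001 if μ > 1000. -/

import Mathlib

/-- Membership in the sequence space `ℓ¹` (with weights `1, 2, 2, …`, which is
equivalent to plain absolute summability). -/
def l1Mem (y : ℕ → ℝ) : Prop := Summable fun j => |y j|

/-- The `ℓ¹` norm `‖y‖ = |y_0| + 2 Σ_{j≥1} |y_j|`. -/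
noncomputable def l1Norm (y : ℕ → ℝ) : ℝ := |y 0| + 2 * ∑' j : ℕ, |y (j + 1)|

/-- The linear operator `L_μ` on sequences:
`(L_μ a)_0 = a_0 + 2 Σ_{ℓ≥1} (−1)^ℓ a_ℓ` and
`(L_μ a)_j = μ a_{j−1} + 2j a_j − μ a_{j+1}` for `j ≥ 1`. -/
noncomputable def Lop (μ : ℝ) (a : ℕ → ℝ) : ℕ → ℝ
  | 0 => a 0 + 2 * ∑' ℓ : ℕ, (-1 : ℝ) ^ (ℓ + 1) * a (ℓ + 1)
  | j + 1 => μ * a j + 2 * ((j : ℝ) + 1) * a (j + 1) - μ * a (j + 2)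

open Filter Topology Finset

/-- The increasing solution, with initial values `1, 1`, of
`K_{j+2} = K_j + (2 (j+1) / μ) K_{j+1}`. -/
noncomputable def growSol (μ : ℝ) : ℕ → ℝ
  | 0 => 1
  | 1 => 1
  | j + 2 => growSol μ j + 2 * ((j : ℝ) + 1) / μ * growSol μ (j + 1)

/-- A positive solution of `h_j = h_{j+2} + (2 (j+1) / μ) h_{j+1}`, normalized through its
Casoratian with `growSol μ`. -/
structure IsDecaySol (μ : ℝ) (h : ℕ → ℝ) : Prop where
  pos : ∀ j, 0 < h j
  recur : ∀ j, h j = h (j + 2) + 2 * ((j : ℝ) + 1) / μ * h (j + 1)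
  casoratian : ∀ j, growSol μ (j + 1) * h j + growSol μ j * h (j + 1) = 1 / μ

lemma growSol_add_two (μ : ℝ) (j : ℕ) :
    growSol μ (j + 2) = growSol μ j + 2 * ((j : ℝ) + 1) / μ * growSol μ (j + 1) := by
  rw [growSol]

lemma growSol_pos {μ : ℝ} (hμ : 0 < μ) (j : ℕ) : 0 < growSol μ j := by
  suffices h : 0 < growSol μ j ∧ 0 < growSol μ (j + 1) from h.1
  induction j with
  | zero => simp [growSol]
  | succ j ih =>
    refine ⟨ih.2, ?_⟩
    rw [growSol_add_two]
    have := ih.1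
    have := ih.2
    positivity

lemma growSol_monotone {μ : ℝ} (hμ : 0 < μ) : Monotone (growSol μ) := by
  refine monotone_nat_of_le_succ fun j => ?_
  suffices h : growSol μ j ≤ growSol μ (j + 1) ∧
      growSol μ (j + 1) - growSol μ j ≤ 2 * (j : ℝ) / μ * growSol μ j from h.1
  induction j with
  | zero => simp [growSol]
  | succ j ih =>
    obtain ⟨h1, h2⟩ := ih
    have hK := growSol_pos hμ j
    have h3 : 2 * (j : ℝ) / μ * growSol μ j ≤ 2 * ((j : ℝ) + 1) / μ * growSol μ (j + 1) := by
      gcongr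
      linarith
    rw [growSol_add_two]
    push_cast
    constructor <;> linarith

lemma one_le_growSol {μ : ℝ} (hμ : 0 < μ) (j : ℕ) : 1 ≤ growSol μ j :=
  growSol_monotone hμ (Nat.zero_le j)

lemma exists_isDecaySol {μ : ℝ} (hμ : 0 < μ) : ∃ h, IsDecaySol μ h := by
  set K := growSol μ
  have hK : ∀ j, 0 < K j := growSol_pos hμ
  have hmono : Monotone K := growSol_monotone hμ
  let t : ℕ → ℝ := fun i => 1 / (μ * (K i * K (i + 1)))
  have ht : Antitone t := by
    intro i j hij
    have h1 := hmono hij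
    have h2 := hmono (Nat.succ_le_succ hij)
    have h3 := hK i
    have h4 := hK (i + 1)
    have h5 := hK j
    dsimp only [t]
    gcongr
  have ht0 : Tendsto t atTop (𝓝 0) := by
    rw [← tendsto_add_atTop_iff_nat 1]
    refine squeeze_zero (g := fun n : ℕ => 1 / ((n : ℝ) + 1)) (fun n => ?_) (fun n => ?_)
      tendsto_one_div_add_atTop_nhds_zero_nat
    · have h3 := hK (n + 1)
      have h4 := hK (n + 1 + 1)
      positivity
    · have h1 : 1 ≤ K (n + 1) := one_le_growSol hμ _
      have h2 : K (n + 1 + 1) = K n + 2 * ((n : ℝ) + 1) / μ * K (n + 1) := growSol_add_two μ n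
      have h3 := hK n
      have h4 : 2 * ((n : ℝ) + 1) / μ ≤ K (n + 1) * K (n + 1 + 1) := by
        rw [h2]
        have : 0 ≤ 2 * ((n : ℝ) + 1) / μ := by positivity
        nlinarith [mul_le_mul h1 h1 zero_le_one (by linarith), mul_pos h3 (hK (n + 1))]
      dsimp only [t]
      gcongr
      calc (n : ℝ) + 1 ≤ μ * (2 * ((n : ℝ) + 1) / μ) := by
            rw [mul_div_cancel₀ _ hμ.ne']; linarith [(n.cast_nonneg : (0 : ℝ) ≤ n)]
        _ ≤ _ := by gcongr
  obtain ⟨S, hS⟩ := ht.tendsto_alternating_series_of_tendsto_zero ht0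
  let h : ℕ → ℝ := fun j => K j * ((-1) ^ j * (S - ∑ i ∈ range j, (-1) ^ i * t i))
  have hnn : ∀ j, 0 ≤ h j := by
    intro j
    refine mul_nonneg (hK j).le ?_
    obtain ⟨k, rfl | rfl⟩ := Nat.even_or_odd' j
    · have := ht.alternating_series_le_tendsto hS k
      rw [pow_mul]
      simpa using this
    · have := ht.tendsto_le_alternating_series hS k
      rw [pow_succ, pow_mul]
      simpa using this
  have hcas : ∀ j, K (j + 1) * h j + K j * h (j + 1) = 1 / μ := by
    intro j
    have h1 := hK j
    have h2 := hK (j + 1)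
    have h3 : ((-1 : ℝ) ^ j) * (-1) ^ j = 1 := by rw [← mul_pow]; simp
    dsimp only [h]
    rw [sum_range_succ, pow_succ]
    have : K (j + 1) * (K j * ((-1) ^ j * (S - ∑ i ∈ range j, (-1) ^ i * t i))) +
        K j * (K (j + 1) * ((-1) ^ j * -1 *
          (S - (∑ i ∈ range j, (-1) ^ i * t i + (-1) ^ j * t j)))) =
        ((-1) ^ j * (-1) ^ j) * (K j * K (j + 1) * t j) := by ring
    rw [this, h3]
    dsimp only [t]
    field_simp
  have hrec : ∀ j, h j = h (j + 2) + 2 * ((j : ℝ) + 1) / μ * h (j + 1) := by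
    intro j
    have h1 := hcas j
    have h2 := hcas (j + 1)
    have h3 : K (j + 1 + 1) = K j + 2 * ((j : ℝ) + 1) / μ * K (j + 1) := growSol_add_two μ j
    rw [h3] at h2
    refine mul_left_cancel₀ (hK (j + 1)).ne' ?_
    linear_combination h1 - h2
  refine ⟨h, fun j => (hnn j).lt_of_ne' fun hj => ?_, hrec, hcas⟩
  have h1 := hcas j
  have h2 : h (j + 1) = 0 := by
    have h3 := hrec j
    have h4 := hnn (j + 2)
    have h5 : 0 < 2 * ((j : ℝ) + 1) / μ := by positivity
    have h6 := mul_nonneg h5.le (hnn (j + 1))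
    have h7 : 2 * ((j : ℝ) + 1) / μ * h (j + 1) = 0 := by linarith
    exact (mul_eq_zero.1 h7).resolve_left h5.ne'
  rw [hj, h2] at h1
  have : 0 < 1 / μ := by positivity
  linarith

namespace IsDecaySol

variable {μ : ℝ} {h : ℕ → ℝ}

lemma growSol_mul_le (hh : IsDecaySol μ h) (hμ : 0 < μ) (k : ℕ) :
    growSol μ k * (h k + h (k + 1)) ≤ 1 / μ := by
  rw [← hh.casoratian k]
  have := mul_le_mul_of_nonneg_right (growSol_monotone hμ k.le_succ) (hh.pos k).le
  linarith

lemma antitone_add_succ (hh : IsDecaySol μ h) (hμ : 0 < μ) :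
    Antitone fun j => h j + h (j + 1) := by
  refine antitone_nat_of_succ_le fun j => ?_
  have h1 := hh.recur j
  have h2 := hh.pos (j + 1)
  have : 0 ≤ 2 * ((j : ℝ) + 1) / μ * h (j + 1) := by positivity
  change h (j + 1) + h (j + 2) ≤ _
  linarith

lemma sum_tail_le (hh : IsDecaySol μ h) (hμ : 0 < μ) (k n : ℕ) :
    ∑ i ∈ range n, h (i + (k + 1)) ≤ μ / (2 * ((k : ℝ) + 1)) * (h k + h (k + 1)) := by
  suffices hs : ∑ i ∈ range n, h (i + (k + 1)) ≤
      μ / (2 * ((k : ℝ) + 1)) * ((h k + h (k + 1)) - (h (k + n) + h (k + n + 1))) by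
    refine hs.trans ?_
    gcongr
    linarith [hh.pos (k + n), hh.pos (k + n + 1)]
  induction n with
  | zero => simp
  | succ n ih =>
    rw [sum_range_succ]
    have h1 := hh.recur (k + n)
    have h2 := hh.pos (k + n + 1)
    have h3 : h (n + (k + 1)) ≤ μ / (2 * ((k : ℝ) + 1)) * (h (k + n) - h (k + n + 2)) := by
      rw [h1, show n + (k + 1) = k + n + 1 by ring]
      push_cast
      have : μ / (2 * ((k : ℝ) + 1)) * (2 * ((k : ℝ) + n + 1) / μ * h (k + n + 1))
          = (((k : ℝ) + n + 1) / (k + 1)) * h (k + n + 1) := by field_simp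
      have h4 : 1 ≤ ((k : ℝ) + n + 1) / (k + 1) := by
        rw [le_div_iff₀ (by positivity)]
        linarith [(n.cast_nonneg : (0 : ℝ) ≤ n)]
      rw [add_sub_cancel_left, this]
      nlinarith
    have h5 : h (k + (n + 1)) + h (k + (n + 1) + 1) = h (k + n + 1) + h (k + n + 2) := rfl
    rw [h5]
    linarith

lemma summable (hh : IsDecaySol μ h) (hμ : 0 < μ) : Summable h := by
  rw [← summable_nat_add_iff 1]
  exact summable_of_sum_range_le (fun _ => (hh.pos _).le) (hh.sum_tail_le hμ 0)

lemma tsum_tail_le (hh : IsDecaySol μ h) (hμ : 0 < μ) (k : ℕ) :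
    ∑' i, h (i + (k + 1)) ≤ μ / (2 * ((k : ℝ) + 1)) * (h k + h (k + 1)) :=
  Real.tsum_le_of_sum_range_le (fun _ => (hh.pos _).le) (hh.sum_tail_le hμ k)

lemma two_mul_sum_le (hh : IsDecaySol μ h) (hμ : 0 < μ) (k n : ℕ) :
    2 * ∑ i ∈ range n, h (i + (k + 1)) ≤ ((n : ℝ) + 1) * (h k + h (k + 1)) := by
  suffices hs : 2 * ∑ i ∈ range n, h (i + (k + 1)) + h k ≤
      (n : ℝ) * (h k + h (k + 1)) + h (k + n) by
    have h1 := hh.antitone_add_succ hμ (Nat.le_add_right k n)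
    dsimp only at h1
    linarith [hh.pos (k + n + 1), hh.pos k]
  induction n with
  | zero => simp
  | succ n ih =>
    have h1 := hh.antitone_add_succ hμ (Nat.le_add_right k n)
    dsimp only at h1
    rw [sum_range_succ, show n + (k + 1) = k + n + 1 by ring, ← add_assoc k n 1]
    push_cast
    linarith

/-- The tail beyond `k < N`, split at `N`. -/
lemma two_mul_tsum_tail_le (hh : IsDecaySol μ h) (hμ : 0 < μ) {k N : ℕ} (hk : k < N) :
    2 * ∑' i, h (i + (k + 1)) ≤ ((N : ℝ) - k + μ / N) * (h k + h (k + 1)) := by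
  obtain ⟨n, rfl⟩ := Nat.exists_eq_add_of_lt hk
  have h1 := hh.two_mul_sum_le hμ k n
  have h2 := hh.tsum_tail_le hμ (k + n)
  have h3 := hh.antitone_add_succ hμ (Nat.le_add_right k n)
  dsimp only at h3
  have hs : Summable fun i => h (i + (k + 1)) := (summable_nat_add_iff (k + 1)).2 (hh.summable hμ)
  rw [← hs.sum_add_tsum_nat_add n]
  have h4 : ∀ i, i + n + (k + 1) = i + (k + n + 1) := fun i => by ring
  simp only [h4]
  have h5 : μ / (2 * (((k + n : ℕ) : ℝ) + 1)) * (h (k + n) + h (k + n + 1)) ≤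
      μ / (2 * (((k + n : ℕ) : ℝ) + 1)) * (h k + h (k + 1)) := by gcongr
  have h6 : μ / ((k + n + 1 : ℕ) : ℝ) = 2 * (μ / (2 * (((k + n : ℕ) : ℝ) + 1))) := by
    push_cast
    field_simp
  rw [h6]
  push_cast at *
  linarith

end IsDecaySol

/-- Once `N² ≳ μ`, the sum of `growSol μ` is controlled by its last two terms. -/
lemma growSol_sum_le {μ : ℝ} (hμ : 0 < μ) {N k : ℕ} (hN : 1 ≤ N)
    (hNμ : 2 * (N : ℝ) - 1 - 2 * μ / N ≤ 3) (hk : N ≤ k + 1) :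
    1 + 2 * ∑ i ∈ range k, growSol μ (i + 1) ≤
      μ / N * (growSol μ (k + 1) + growSol μ k) + 3 * growSol μ k := by
  have hN0 : (0 : ℝ) < N := by exact_mod_cast hN
  obtain ⟨M, rfl⟩ := Nat.exists_eq_add_of_le' hN
  have hk' : M ≤ k := by omega
  induction k, hk' using Nat.le_induction with
  | base =>
    have hM := growSol_pos hμ M
    have h1 : ∑ i ∈ range M, growSol μ (i + 1) ≤ M * growSol μ M := by
      refine (sum_le_card_nsmul _ _ (growSol μ M) fun i hi => ?_).trans (by simp)
      exact growSol_monotone hμ (mem_range.1 hi)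
    have h2 := one_le_growSol hμ M
    have h3 : μ / ((M + 1 : ℕ) : ℝ) * growSol μ M ≤ μ / ((M + 1 : ℕ) : ℝ) * growSol μ (M + 1) := by
      gcongr
      exact growSol_monotone hμ M.le_succ
    have h4 := mul_le_mul_of_nonneg_right hNμ hM.le
    rw [show 2 * μ / ((M + 1 : ℕ) : ℝ) = 2 * (μ / ((M + 1 : ℕ) : ℝ)) by ring] at h4
    generalize μ / ((M + 1 : ℕ) : ℝ) = c at *
    push_cast at h4
    linarith
  | succ k hMk ih =>
    have ih := ih (by omega)
    rw [sum_range_succ, growSol_add_two]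
    have h1 := growSol_pos hμ (k + 1)
    have h2 := growSol_monotone hμ k.le_succ
    have h3 : growSol μ (k + 1) ≤
        μ / ((M + 1 : ℕ) : ℝ) * (((k : ℝ) + 1) / μ * growSol μ (k + 1)) := by
      have : μ / ((M + 1 : ℕ) : ℝ) * (((k : ℝ) + 1) / μ * growSol μ (k + 1)) =
        ((k : ℝ) + 1) / ((M + 1 : ℕ) : ℝ) * growSol μ (k + 1) := by field_simp
      rw [this]
      refine le_mul_of_one_le_left h1.le ?_
      rw [one_le_div hN0]
      push_cast
      have : (M : ℝ) ≤ k := by exact_mod_cast hMk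
      linarith
    have h4 : 2 * ((k : ℝ) + 1) / μ = 2 * (((k : ℝ) + 1) / μ) := by ring
    rw [h4]
    generalize μ / ((M + 1 : ℕ) : ℝ) = c at *
    simp only [Nat.succ_eq_add_one] at h2
    linarith

/-- The weights `1, 2, 2, …` of the `ℓ¹` norm. -/
def l1Weight (j : ℕ) : ℝ := if j = 0 then 1 else 2

lemma l1Weight_nonneg (j : ℕ) : 0 ≤ l1Weight j := by
  unfold l1Weight; split_ifs <;> norm_num

lemma l1Weight_le (j : ℕ) : l1Weight j ≤ 2 := by
  unfold l1Weight; split_ifs <;> norm_num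

lemma one_le_l1Weight (j : ℕ) : 1 ≤ l1Weight j := by
  unfold l1Weight; split_ifs <;> norm_num

lemma summable_l1Weight_mul {f : ℕ → ℝ} (hf : Summable f) : Summable fun j => l1Weight j * f j := by
  refine Summable.of_norm_bounded (hf.abs.mul_left 2) fun j => ?_
  rw [Real.norm_eq_abs, abs_mul, abs_of_nonneg (l1Weight_nonneg j)]
  gcongr
  exact l1Weight_le j

lemma tsum_l1Weight_mul {f : ℕ → ℝ} (hf : Summable f) :
    ∑' j, l1Weight j * f j = f 0 + 2 * ∑' j, f (j + 1) := by
  rw [(summable_l1Weight_mul hf).tsum_eq_zero_add, ← tsum_mul_left]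
  simp [l1Weight]

lemma l1Norm_eq_tsum {a : ℕ → ℝ} (ha : l1Mem a) : l1Norm a = ∑' j, l1Weight j * |a j| :=
  (tsum_l1Weight_mul ha).symm

lemma l1Mem.summable_alternating {a : ℕ → ℝ} (ha : l1Mem a) :
    Summable fun j => (-1 : ℝ) ^ j * a j :=
  (Summable.of_abs ha).alternating

lemma Lop_zero_eq_tsum {a : ℕ → ℝ} (μ : ℝ) (ha : l1Mem a) :
    Lop μ a 0 = ∑' j, l1Weight j * ((-1) ^ j * a j) := by
  rw [tsum_l1Weight_mul ha.summable_alternating]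
  simp [Lop]

lemma abs_Lop_zero_le {a : ℕ → ℝ} (μ : ℝ) (ha : l1Mem a) : |Lop μ a 0| ≤ l1Norm a := by
  have hs : Summable fun j => ‖l1Weight j * ((-1) ^ j * a j)‖ :=
    (summable_l1Weight_mul ha.summable_alternating).abs
  rw [Lop_zero_eq_tsum μ ha, l1Norm_eq_tsum ha]
  refine (norm_tsum_le_tsum_norm hs).trans_eq ?_
  simp [abs_of_nonneg (l1Weight_nonneg _)]

lemma abs_le_l1Norm {a : ℕ → ℝ} (ha : l1Mem a) (j : ℕ) : |a j| ≤ l1Norm a := by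
  rw [l1Norm_eq_tsum ha]
  refine le_trans ?_ ((summable_l1Weight_mul ha).le_tsum j fun i _ =>
    mul_nonneg (l1Weight_nonneg i) (abs_nonneg _))
  exact le_mul_of_one_le_left (abs_nonneg _) (one_le_l1Weight j)

lemma l1Mem.add_const_mul {a b : ℕ → ℝ} (ha : l1Mem a) (hb : l1Mem b) (c : ℝ) :
    l1Mem fun j => a j + c * b j :=
  ((Summable.of_abs ha).add ((Summable.of_abs hb).mul_left c)).abs

lemma l1Norm_add_const_mul_le {a b : ℕ → ℝ} (ha : l1Mem a) (hb : l1Mem b) (c : ℝ) :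
    l1Norm (fun j => a j + c * b j) ≤ l1Norm a + |c| * l1Norm b := by
  have ha' := summable_l1Weight_mul ha
  have hb' := summable_l1Weight_mul hb
  rw [l1Norm_eq_tsum ha, l1Norm_eq_tsum hb, l1Norm_eq_tsum (ha.add_const_mul hb c),
    ← tsum_mul_left, ← ha'.tsum_add (hb'.mul_left _)]
  refine (summable_l1Weight_mul (ha.add_const_mul hb c)).tsum_le_tsum (fun j => ?_)
    (ha'.add (hb'.mul_left _))
  have h1 := abs_add_le (a j) (c * b j)
  rw [abs_mul] at h1
  have h2 := mul_le_mul_of_nonneg_left h1 (l1Weight_nonneg j)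
  linarith

lemma Lop_add_const_mul {a b : ℕ → ℝ} (μ : ℝ) (ha : l1Mem a) (hb : l1Mem b) (c : ℝ) (i : ℕ) :
    Lop μ (fun j => a j + c * b j) i = Lop μ a i + c * Lop μ b i := by
  cases i with
  | zero =>
    have ha' := summable_l1Weight_mul ha.summable_alternating
    have hb' := summable_l1Weight_mul hb.summable_alternating
    rw [Lop_zero_eq_tsum μ ha, Lop_zero_eq_tsum μ hb, Lop_zero_eq_tsum μ (ha.add_const_mul hb c),
      ← tsum_mul_left, ← ha'.tsum_add (hb'.mul_left _)]
    exact tsum_congr fun j => by ring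
  | succ i => simp only [Lop]; ring

/-- The solution of the rows `j ≥ 1` of `L_μ b = e_k` built from `growSol μ` and `h`. -/
noncomputable def greenCol (μ : ℝ) (h : ℕ → ℝ) (k j : ℕ) : ℝ :=
  if j ≤ k then growSol μ j * h k else (-1) ^ (j + k) * h j * growSol μ k

namespace IsDecaySol

variable {μ : ℝ} {h : ℕ → ℝ}

lemma l1Mem_alternating (hh : IsDecaySol μ h) (hμ : 0 < μ) : l1Mem fun j => (-1) ^ j * h j :=
  (hh.summable hμ).alternating.abs

lemma l1Norm_pos (hh : IsDecaySol μ h) : 0 < l1Norm h := by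
  have h1 : 0 ≤ ∑' j : ℕ, |h (j + 1)| := tsum_nonneg fun _ => abs_nonneg _
  have h2 := abs_pos.2 (hh.pos 0).ne'
  unfold l1Norm
  linarith

lemma l1Norm_alternating (h : ℕ → ℝ) : l1Norm (fun j => (-1) ^ j * h j) = l1Norm h := by
  simp [l1Norm, abs_mul]

lemma Lop_alternating (hh : IsDecaySol μ h) (hμ : 0 < μ) :
    Lop μ (fun j => (-1) ^ j * h j) = Pi.single 0 (l1Norm h) := by
  ext i
  cases i with
  | zero =>
    rw [Lop_zero_eq_tsum μ (hh.l1Mem_alternating hμ), Pi.single_eq_same,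
      l1Norm_eq_tsum (hh.summable hμ).abs]
    refine tsum_congr fun j => ?_
    rw [← mul_assoc ((-1 : ℝ) ^ j), ← mul_pow, abs_of_pos (hh.pos j)]
    simp
  | succ i =>
    rw [Pi.single_eq_of_ne i.succ_ne_zero]
    simp only [Lop]
    rw [hh.recur i, pow_succ, pow_add]
    field_simp
    ring

lemma Lop_greenCol_succ (hh : IsDecaySol μ h) (hμ : 0 < μ) (k i : ℕ) :
    Lop μ (greenCol μ h k) (i + 1) = (Pi.single k 1 : ℕ → ℝ) (i + 1) := by
  simp only [Lop, greenCol]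
  rcases lt_trichotomy (i + 1) k with hik | rfl | hik
  · rw [if_pos (by omega), if_pos (by omega), if_pos (by omega), Pi.single_eq_of_ne (by omega),
      growSol_add_two]
    field_simp
    ring
  · rw [if_pos (by omega), if_pos le_rfl, if_neg (by omega), Pi.single_eq_same]
    have h1 := hh.casoratian i
    rw [hh.recur i] at h1
    have h2 : (-1 : ℝ) ^ (i + 2 + (i + 1)) = -1 := Odd.neg_one_pow ⟨i + 1, by ring⟩
    rw [h2]
    field_simp at h1 ⊢
    linarith
  · rw [Pi.single_eq_of_ne (by omega), if_neg (show ¬ i + 1 ≤ k by omega),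
      if_neg (show ¬ i + 2 ≤ k by omega)]
    have h1 : (if i ≤ k then growSol μ i * h k else (-1) ^ (i + k) * h i * growSol μ k) =
        (-1) ^ (i + k) * h i * growSol μ k := by
      split_ifs with hi
      · obtain rfl : i = k := by omega
        rw [Even.neg_one_pow ⟨i, rfl⟩]
        ring
      · rfl
    rw [h1, hh.recur i, show i + 1 + k = i + k + 1 by ring, show i + 2 + k = i + k + 2 by ring,
      pow_succ, pow_add]
    field_simp
    ring

lemma abs_greenCol_of_le (hh : IsDecaySol μ h) (hμ : 0 < μ) {k j : ℕ} (hj : j ≤ k) :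
    |greenCol μ h k j| = growSol μ j * h k := by
  rw [greenCol, if_pos hj, abs_of_pos (mul_pos (growSol_pos hμ j) (hh.pos k))]

lemma abs_greenCol_of_lt (hh : IsDecaySol μ h) (hμ : 0 < μ) {k j : ℕ} (hj : k < j) :
    |greenCol μ h k j| = h j * growSol μ k := by
  rw [greenCol, if_neg hj.not_ge, mul_assoc, abs_mul, abs_pow, abs_neg, abs_one, one_pow, one_mul,
    abs_of_pos (mul_pos (hh.pos j) (growSol_pos hμ k))]

lemma l1Mem_greenCol (hh : IsDecaySol μ h) (hμ : 0 < μ) (k : ℕ) : l1Mem (greenCol μ h k) := by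
  unfold l1Mem
  rw [← summable_nat_add_iff (k + 1)]
  have h1 := ((summable_nat_add_iff (k + 1)).2 (hh.summable hμ)).mul_right (growSol μ k)
  exact h1.congr fun i => (hh.abs_greenCol_of_lt hμ (by omega)).symm

lemma l1Norm_greenCol (hh : IsDecaySol μ h) (hμ : 0 < μ) (k : ℕ) :
    l1Norm (greenCol μ h k) = (1 + 2 * ∑ i ∈ range k, growSol μ (i + 1)) * h k +
      2 * (∑' i, h (i + (k + 1))) * growSol μ k := by
  have hs : Summable fun j => |greenCol μ h k (j + 1)| :=
    (summable_nat_add_iff (f := fun j => |greenCol μ h k j|) 1).2 (hh.l1Mem_greenCol hμ k)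
  have h0 : growSol μ 0 = 1 := by rw [growSol]
  have h1 : ∑ i ∈ range k, |greenCol μ h k (i + 1)| =
      (∑ i ∈ range k, growSol μ (i + 1)) * h k := by
    rw [sum_mul]
    exact sum_congr rfl fun i hi => hh.abs_greenCol_of_le hμ (mem_range.1 hi)
  have h2 : ∑' i, |greenCol μ h k (i + k + 1)| = (∑' i, h (i + (k + 1))) * growSol μ k := by
    rw [← tsum_mul_right]
    exact tsum_congr fun i => hh.abs_greenCol_of_lt hμ (by omega)
  rw [l1Norm, hh.abs_greenCol_of_le hμ k.zero_le, ← hs.sum_add_tsum_nat_add k, h0, h1, h2]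
  ring

lemma l1Norm_greenCol_le (hh : IsDecaySol μ h) (hμ : 10 < μ) (k : ℕ) :
    l1Norm (greenCol μ h k) ≤ 1.455 := by
  have hμ0 : 0 < μ := by linarith
  set s := √μ
  have hss : s * s = μ := Real.mul_self_sqrt hμ0.le
  have hs3 : 3.16 < s := Real.lt_sqrt_of_sq_lt (by norm_num; linarith)
  set N := ⌈s⌉₊
  have hsN : s ≤ N := Nat.le_ceil s
  have hNs : (N : ℝ) < s + 1 := Nat.ceil_lt_add_one (by linarith)
  have hN0 : (0 : ℝ) < N := by linarith
  have hN1 : 1 ≤ N := by exact_mod_cast hN0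
  have hμN : μ / N ≤ s := by
    rw [div_le_iff₀ hN0]
    nlinarith
  have hB : (3 * s + 3) * (1 / μ) ≤ 1.455 := by
    rw [mul_one_div, div_le_iff₀ hμ0]
    nlinarith
  have hw := hh.growSol_mul_le hμ0 k
  have hK := growSol_pos hμ0 k
  have hk0 := hh.pos k
  have hk1 := hh.pos (k + 1)
  have hKh : growSol μ k * h k ≤ 1 / μ := by nlinarith
  have hp : 0 < 1 / μ := by positivity
  rw [hh.l1Norm_greenCol hμ0]
  refine le_trans ?_ hB
  rcases lt_or_ge k N with hkN | hkN
  · have h1 := mul_le_mul_of_nonneg_right (hh.two_mul_tsum_tail_le hμ0 hkN) hK.le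
    have hkN' : (k : ℝ) + 1 ≤ N := by exact_mod_cast hkN
    have h2 : ((N : ℝ) - k + μ / N) * (growSol μ k * (h k + h (k + 1))) ≤
        ((N : ℝ) - k + μ / N) * (1 / μ) := by
      have : 0 ≤ (N : ℝ) - k + μ / N := by
        have : 0 ≤ μ / N := by positivity
        linarith
      gcongr
    have h3 : ∑ i ∈ range k, growSol μ (i + 1) ≤ k * growSol μ k := by
      refine (sum_le_card_nsmul _ _ (growSol μ k) fun i hi => ?_).trans (by simp)
      exact growSol_monotone hμ0 (mem_range.1 hi)
    have h4 : (1 + 2 * ∑ i ∈ range k, growSol μ (i + 1)) * h k ≤ (1 + 2 * k) * (1 / μ) := by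
      have h5 := one_le_growSol hμ0 k
      calc _ ≤ ((1 + 2 * k) * growSol μ k) * h k := by gcongr; linarith
        _ = (1 + 2 * k) * (growSol μ k * h k) := by ring
        _ ≤ _ := by gcongr
    have h6 : ((N : ℝ) - k + μ / N + (1 + 2 * k)) * (1 / μ) ≤ (3 * s + 3) * (1 / μ) := by
      refine mul_le_mul_of_nonneg_right ?_ hp.le
      linarith
    linarith
  · have h1 := mul_le_mul_of_nonneg_right (hh.tsum_tail_le hμ0 k) hK.le
    have hkN' : (N : ℝ) ≤ k := by exact_mod_cast hkN
    have h2 : μ / (2 * ((k : ℝ) + 1)) * (growSol μ k * (h k + h (k + 1))) ≤ s / 2 * (1 / μ) := by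
      have h3 : μ / (2 * ((k : ℝ) + 1)) ≤ s / 2 := by
        rw [div_le_iff₀ (by positivity)]
        nlinarith
      gcongr
    have hc : 2 * (N : ℝ) - 1 - 2 * μ / N ≤ 3 := by
      have : 2 * (N : ℝ) - 4 ≤ 2 * μ / N := by
        rw [le_div_iff₀ hN0]
        nlinarith
      linarith
    have h4 := mul_le_mul_of_nonneg_right
      (growSol_sum_le hμ0 hN1 hc (Nat.le_succ_of_le hkN)) hk0.le
    have h5 : growSol μ (k + 1) * h k + growSol μ k * h k ≤ 2 * (1 / μ) := by
      have := hh.casoratian k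
      nlinarith
    have h6 : μ / N * (growSol μ (k + 1) * h k + growSol μ k * h k) ≤ s * (2 * (1 / μ)) := by
      have := growSol_pos hμ0 (k + 1)
      gcongr
    linarith

/-- The columns of the inverse of `L_μ`. -/
lemma exists_column (hh : IsDecaySol μ h) (hμ : 10 < μ) (k : ℕ) :
    ∃ g : ℕ → ℝ, l1Mem g ∧ Lop μ g = Pi.single k 1 ∧ l1Norm g ≤ 1.455 * l1Weight k := by
  have hμ0 : 0 < μ := by linarith
  have hH := hh.l1Norm_pos
  have hp := hh.l1Mem_alternating hμ0
  have hLp := hh.Lop_alternating hμ0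
  rcases k.eq_zero_or_pos with rfl | hk
  · have h0 : l1Mem fun _ : ℕ => (0 : ℝ) := by simp [l1Mem, summable_zero]
    refine ⟨_, h0.add_const_mul hp (l1Norm h)⁻¹, ?_, ?_⟩
    · ext i
      rw [Lop_add_const_mul μ h0 hp, hLp]
      cases i <;> simp [Lop, hH.ne']
    · refine (l1Norm_add_const_mul_le h0 hp _).trans ?_
      rw [l1Norm_alternating, abs_of_pos (inv_pos.2 hH), inv_mul_cancel₀ hH.ne']
      norm_num [l1Norm, l1Weight]
  · have hb := hh.l1Mem_greenCol hμ0 k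
    refine ⟨_, hb.add_const_mul hp (-Lop μ (greenCol μ h k) 0 / l1Norm h), ?_, ?_⟩
    · ext i
      rw [Lop_add_const_mul μ hb hp, hLp]
      cases i with
      | zero =>
        rw [Pi.single_eq_same, Pi.single_eq_of_ne hk.ne, div_mul_cancel₀ _ hH.ne', add_neg_cancel]
      | succ i =>
        rw [hh.Lop_greenCol_succ hμ0, Pi.single_eq_of_ne i.succ_ne_zero, mul_zero, add_zero]
    · refine (l1Norm_add_const_mul_le hb hp _).trans ?_
      rw [l1Norm_alternating, abs_div, abs_of_pos hH, div_mul_cancel₀ _ hH.ne', abs_neg]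
      have h1 := abs_Lop_zero_le μ hb
      have h2 := hh.l1Norm_greenCol_le hμ k
      rw [l1Weight, if_neg hk.ne']
      linarith

lemma eq_zero_of_Lop_eq_zero (hh : IsDecaySol μ h) (hμ : 0 < μ) {a : ℕ → ℝ} (ha : l1Mem a)
    (hL : Lop μ a = 0) : a = 0 := by
  have hrec : ∀ j, a (j + 2) = a j + 2 * ((j : ℝ) + 1) / μ * a (j + 1) := by
    intro j
    have h1 : μ * a j + 2 * ((j : ℝ) + 1) * a (j + 1) - μ * a (j + 2) = 0 := congrFun hL (j + 1)
    field_simp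
    linarith
  have hconst : ∀ j, h j * a (j + 1) + h (j + 1) * a j = h 0 * a 1 + h 1 * a 0 := by
    intro j
    induction j with
    | zero => rfl
    | succ j ih =>
      rw [← ih, hrec j, hh.recur j]
      ring
  have ht : Tendsto h atTop (𝓝 0) := (hh.summable hμ).tendsto_atTop_zero
  have hat : Tendsto a atTop (𝓝 0) := (Summable.of_abs ha).tendsto_atTop_zero
  have hW : h 0 * a 1 + h 1 * a 0 = 0 := by
    have h1 : Tendsto (fun j => h j * a (j + 1) + h (j + 1) * a j) atTop (𝓝 (0 * 0 + 0 * 0)) :=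
      (ht.mul ((tendsto_add_atTop_iff_nat 1).2 hat)).add
        (((tendsto_add_atTop_iff_nat 1).2 ht).mul hat)
    simp only [hconst] at h1
    simpa using tendsto_nhds_unique tendsto_const_nhds h1
  obtain ⟨c, hc⟩ : ∃ c, c * h 0 = a 0 := ⟨a 0 / h 0, div_mul_cancel₀ _ (hh.pos 0).ne'⟩
  have hform : ∀ j, a j = 0 + c * ((-1) ^ j * h j) := by
    intro j
    induction j with
    | zero => simp [hc]
    | succ j ih =>
      have h1 := hconst j
      rw [hW, ih] at h1
      refine mul_left_cancel₀ (hh.pos j).ne' ?_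
      rw [pow_succ]
      linear_combination h1
  have h0 : l1Mem fun _ : ℕ => (0 : ℝ) := by simp [l1Mem, summable_zero]
  have hrow : Lop μ a 0 = 0 := congrFun hL 0
  rw [funext hform, Lop_add_const_mul μ h0 (hh.l1Mem_alternating hμ), hh.Lop_alternating hμ] at hrow
  have hc0 : c = 0 := by simpa [Lop, hh.l1Norm_pos.ne'] using hrow
  ext j
  simp [hform j, hc0]

end IsDecaySol

/-- Superposition of columns `g k` solving `L_μ (g k) = e_k` with uniformly bounded norms. -/
lemma exists_solution_of_columns {μ C : ℝ} {g : ℕ → ℕ → ℝ} (hg : ∀ k, l1Mem (g k))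
    (hL : ∀ k, Lop μ (g k) = Pi.single k 1) (hC : ∀ k, l1Norm (g k) ≤ C * l1Weight k)
    {y : ℕ → ℝ} (hy : l1Mem y) :
    ∃ a, l1Mem a ∧ Lop μ a = y ∧ l1Norm a ≤ C * l1Norm y := by
  let F : ℕ × ℕ → ℝ := fun p => l1Weight p.2 * |y p.1 * g p.1 p.2|
  have hrow : ∀ k, Summable fun j => l1Weight j * |y k * g k j| := fun k =>
    summable_l1Weight_mul ((Summable.of_abs (hg k)).mul_left (y k)).abs
  have hrowsum : ∀ k, ∑' j, l1Weight j * |y k * g k j| = |y k| * l1Norm (g k) := by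
    intro k
    rw [l1Norm_eq_tsum (hg k), ← tsum_mul_left]
    exact tsum_congr fun j => by rw [abs_mul]; ring
  have hbound : ∀ k, |y k| * l1Norm (g k) ≤ C * (l1Weight k * |y k|) := fun k => by
    have := mul_le_mul_of_nonneg_left (hC k) (abs_nonneg (y k))
    linarith
  have hCy : Summable fun k => C * (l1Weight k * |y k|) := (summable_l1Weight_mul hy).mul_left C
  have hyg : Summable fun k => |y k| * l1Norm (g k) :=
    hCy.of_nonneg_of_le (fun k => mul_nonneg (abs_nonneg _)
      ((abs_nonneg _).trans (abs_le_l1Norm (hg k) 0))) hbound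
  have hF : Summable F := by
    refine (summable_prod_of_nonneg fun p =>
      mul_nonneg (l1Weight_nonneg _) (abs_nonneg _)).2 ⟨hrow, ?_⟩
    exact hyg.congr fun k => (hrowsum k).symm
  have hcol : ∀ j, Summable fun k => |y k * g k j| := fun j =>
    hyg.of_nonneg_of_le (fun k => abs_nonneg _) fun k => by
      rw [abs_mul]
      exact mul_le_mul_of_nonneg_left (abs_le_l1Norm (hg k) j) (abs_nonneg _)
  have hF' : Summable fun j => ∑' k, l1Weight j * |y k * g k j| := hF.prod_symm.prod
  let a : ℕ → ℝ := fun j => ∑' k, y k * g k j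
  have hle : ∀ j, l1Weight j * |a j| ≤ ∑' k, l1Weight j * |y k * g k j| := by
    intro j
    have h1 : |∑' k, y k * g k j| ≤ ∑' k, |y k * g k j| :=
      norm_tsum_le_tsum_norm (f := fun k => y k * g k j) (hcol j)
    rw [tsum_mul_left]
    exact mul_le_mul_of_nonneg_left h1 (l1Weight_nonneg j)
  have hwa : Summable fun j => l1Weight j * |a j| :=
    hF'.of_nonneg_of_le (fun j => mul_nonneg (l1Weight_nonneg j) (abs_nonneg _)) hle
  have ha : l1Mem a := hwa.of_nonneg_of_le (fun j => abs_nonneg _) fun j =>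
    le_mul_of_one_le_left (abs_nonneg _) (one_le_l1Weight j)
  have hsingle : ∀ i, ∑' k, y k * (Pi.single k 1 : ℕ → ℝ) i = y i := by
    intro i
    rw [tsum_eq_single i fun k hk => by rw [Pi.single_eq_of_ne hk.symm, mul_zero]]
    simp
  refine ⟨a, ha, ?_, ?_⟩
  · ext i
    rw [← hsingle i]
    simp_rw [← hL]
    cases i with
    | zero =>
      have hsum : Summable fun p : ℕ × ℕ => l1Weight p.2 * ((-1) ^ p.2 * (y p.1 * g p.1 p.2)) := by
        refine Summable.of_norm_bounded hF fun p => ?_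
        simp [F, abs_mul, abs_of_nonneg (l1Weight_nonneg _)]
      have hswap := Summable.tsum_comm (f := fun j k => l1Weight j * ((-1) ^ j * (y k * g k j)))
        hsum.prod_symm
      rw [Lop_zero_eq_tsum μ ha]
      simp_rw [fun k => Lop_zero_eq_tsum μ (hg k), a, ← tsum_mul_left]
      rw [← hswap]
      exact tsum_congr fun k => tsum_congr fun j => by ring
    | succ i =>
      have hs : ∀ j, Summable fun k => y k * g k j := fun j => (hcol j).of_abs
      simp only [Lop, a, ← tsum_mul_left]
      rw [← ((hs i).mul_left μ).tsum_add ((hs (i + 1)).mul_left _),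
        ← (((hs i).mul_left μ).add ((hs (i + 1)).mul_left _)).tsum_sub ((hs (i + 2)).mul_left μ)]
      exact tsum_congr fun k => by ring
  · rw [l1Norm_eq_tsum ha, l1Norm_eq_tsum hy, ← tsum_mul_left]
    calc ∑' j, l1Weight j * |a j| ≤ ∑' j, ∑' k, l1Weight j * |y k * g k j| :=
          hwa.tsum_le_tsum hle hF'
      _ = ∑' k, ∑' j, l1Weight j * |y k * g k j| :=
          (Summable.tsum_comm (f := fun j k => l1Weight j * |y k * g k j|) hF.prod_symm).symm
      _ = ∑' k, |y k| * l1Norm (g k) := tsum_congr hrowsum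
      _ ≤ ∑' k, C * (l1Weight k * |y k|) := hyg.tsum_le_tsum hbound hCy

/-- For `μ > 10`, `L_μ` is boundedly invertible on `ℓ¹` with `‖L_μ⁻¹‖ ≤ C(μ)`, where
`C(μ) = 1.612 + 0.1` for `10 < μ ≤ 100`, `C(μ) = 1.472 + 0.01` for `100 < μ ≤ 1000`,
and `C(μ) = 1.454 + 0.001` for `μ > 1000`. -/
theorem stmt18 (μ : ℝ) (hμ : 10 < μ) :
    ∀ y : ℕ → ℝ, l1Mem y →
      ∃ a : ℕ → ℝ,
        (l1Mem a ∧ Lop μ a = y ∧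
          l1Norm a ≤
            (if μ ≤ 100 then 1.612 + 0.1
             else if μ ≤ 1000 then 1.472 + 0.01
             else 1.454 + 0.001) * l1Norm y) ∧
        ∀ a' : ℕ → ℝ, l1Mem a' → Lop μ a' = y → a' = a := by
  intro y hy
  have hμ0 : 0 < μ := by linarith
  obtain ⟨h, hh⟩ := exists_isDecaySol hμ0
  choose g hg hL hC using hh.exists_column hμ
  obtain ⟨a, ha, hLa, hna⟩ := exists_solution_of_columns hg hL hC hy
  refine ⟨a, ⟨ha, hLa, hna.trans ?_⟩, fun a' ha' hLa' => ?_⟩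
  · refine mul_le_mul_of_nonneg_right ?_ ((abs_nonneg _).trans (abs_le_l1Norm hy 0))
    split_ifs <;> norm_num
  · have hd := ha'.add_const_mul ha (-1)
    have h0 := hh.eq_zero_of_Lop_eq_zero hμ0 hd (by
      ext i
      rw [Lop_add_const_mul μ ha' ha, hLa, hLa']
      simp)
    ext j
    have := congrFun h0 j
    simp only [Pi.zero_apply] at this
    linarith
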